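/- Let E be an exact category with enough projectives and let P̄ be the full subcategory of projective objects of E. Assume P̄ is closed under pullbacks in E. Then E is locally cartesian closed (every slice E/I is cartesian closed) if and only if P̄ has weak dependent products: for all arrows f : X → J and g : Y → X in P̄ there exist an arrow w : W → J in P̄ and a surjection from Hom_{P̄/J}(h, w) to Hom_{P̄/X}(f*(h), g), natural in h ∈ P̄/J, where f*(h) denotes a pullback of h along f. -/

import Mathlib

open CategoryTheory Limits

namespace ExComp

universe v u

variable {E : Type u} [Category.{v} E]

/-- A regular epimorphism, as a property of a morphism. -/
def RegEpi {A B : E} (f : A ⟶ B) : Prop := Nonempty (RegularEpi f)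

/-- An object is (regular) projective if its covariant hom functor sends regular
epimorphisms to surjections. -/
def RegProjective (X : E) : Prop :=
  ∀ ⦃A B : E⦄ (e : A ⟶ B), RegEpi e → ∀ f : X ⟶ B, ∃ g : X ⟶ A, g ≫ e = f

/-- `E` has enough projectives: every object admits a regular epimorphism from a
projective object. -/
def EnoughRegProjectives (E : Type u) [Category.{v} E] : Prop :=
  ∀ A : E, ∃ (X : E) (p : X ⟶ A), RegProjective X ∧ RegEpi p

/-- An internal equivalence relation: a jointly monic, reflexive, symmetric and
transitive pair of parallel arrows. -/
structure IsEquivRelPair {R X : E} (r₁ r₂ : R ⟶ X) : Prop where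
  jointlyMono : ∀ ⦃T : E⦄ (h k : T ⟶ R), h ≫ r₁ = k ≫ r₁ → h ≫ r₂ = k ≫ r₂ → h = k
  refl : ∃ d : X ⟶ R, d ≫ r₁ = 𝟙 X ∧ d ≫ r₂ = 𝟙 X
  symm : ∃ s : R ⟶ R, s ≫ r₁ = r₂ ∧ s ≫ r₂ = r₁
  trans : ∀ ⦃T : E⦄ (p q : T ⟶ R), p ≫ r₂ = q ≫ r₁ →
    ∃ t : T ⟶ R, t ≫ r₁ = p ≫ r₁ ∧ t ≫ r₂ = q ≫ r₂

/-- An exact category: a finitely complete category where every morphism factors as a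
regular epi followed by a mono, regular epis are stable under pullback, and every
internal equivalence relation is effective (it is the kernel pair of the coequaliser
it admits). -/
structure IsExact (E : Type u) [Category.{v} E] [HasFiniteLimits E] : Prop where
  factor : ∀ ⦃A B : E⦄ (f : A ⟶ B), ∃ (I : E) (e : A ⟶ I) (m : I ⟶ B),
    RegEpi e ∧ Mono m ∧ e ≫ m = f
  stable : ∀ ⦃A B C : E⦄ (f : A ⟶ B) (g : C ⟶ B), RegEpi f → RegEpi (pullback.snd f g)
  effective : ∀ ⦃R X : E⦄ (r₁ r₂ : R ⟶ X), IsEquivRelPair r₁ r₂ →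
    ∃ (Q : E) (q : X ⟶ Q) (w : r₁ ≫ q = r₂ ≫ q),
      Nonempty (IsColimit (Cofork.ofπ q w)) ∧ IsPullback r₁ r₂ q q

/-- A projective cover of `E`: a (full sub)collection of objects, each projective,
such that every object of `E` admits a regular epimorphism from one of them. -/
def IsProjectiveCover (P : Set E) : Prop :=
  (∀ X ∈ P, RegProjective X) ∧ ∀ A : E, ∃ X ∈ P, ∃ p : X ⟶ A, RegEpi p

section FinLim
variable [HasFiniteLimits E]

/-- `X` is internally projective: every arrow `T ⨯ X ⟶ B` lifts along a regular epi
`A ↠ B` after passing to a regular epi `U ↠ T`. -/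
def InternallyProjective (X : E) : Prop :=
  ∀ ⦃T A B : E⦄ (e : A ⟶ B), RegEpi e → ∀ f : T ⨯ X ⟶ B,
    ∃ (U : E) (u : U ⟶ T) (g : U ⨯ X ⟶ A), RegEpi u ∧ g ≫ e = prod.map u (𝟙 X) ≫ f

/-- Cartesian closure, as a property: for every object `X` the functor `(−) ⨯ X` has a
right adjoint. -/
def CartesianClosedP (E : Type u) [Category.{v} E] [HasFiniteLimits E] : Prop :=
  ∀ X : E, (prod.functor.flip.obj X).IsLeftAdjoint

/-- Local cartesian closure, as a property: every slice is cartesian closed. -/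
def LocallyCartesianClosedP (E : Type u) [Category.{v} E] [HasFiniteLimits E] : Prop :=
  ∀ (I : E) (F : Over I), ((prod.functor (C := Over I)).flip.obj F).IsLeftAdjoint

end FinLim

/-! ## Weak products and weak simple products -/

/-- A weak product in `P` of `X` and `Y`: a span through which every span in `P`
factors (not necessarily uniquely). -/
structure IsWeakProduct (P : Set E) {X Y V : E} (p : V ⟶ X) (q : V ⟶ Y) : Prop where
  mem : V ∈ P
  lift : ∀ ⦃V' : E⦄, V' ∈ P → ∀ (p' : V' ⟶ X) (q' : V' ⟶ Y),
    ∃ h : V' ⟶ V, h ≫ p = p' ∧ h ≫ q = q'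

/-- An arrow out of a weak product is determined by projections if it coequalises
every pair of arrows (from an object of `P`) coequalised by both projections. -/
def DeterminedByProjections (P : Set E) {V X Y Z : E} (p : V ⟶ X) (q : V ⟶ Y)
    (f : V ⟶ Z) : Prop :=
  ∀ ⦃V' : E⦄, V' ∈ P → ∀ (h k : V' ⟶ V), h ≫ p = k ≫ p → h ≫ q = k ≫ q → h ≫ f = k ≫ f

/-- A candidate diagram for a weak simple product of a span `J ←f Y →g X`. -/
structure WSPCone (P : Set E) {J Y X : E} (f : Y ⟶ J) (g : Y ⟶ X)
    (W V : E) (w : W ⟶ J) (p : V ⟶ W) (q : V ⟶ X) (e : V ⟶ Y) : Prop where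
  memW : W ∈ P
  wp : IsWeakProduct P p q
  det : DeterminedByProjections P p q e
  comm₁ : p ≫ w = e ≫ f
  comm₂ : q = e ≫ g

/-- A weak simple product: a weakly terminal candidate diagram. -/
structure IsWeakSimpleProduct (P : Set E) {J Y X : E} (f : Y ⟶ J) (g : Y ⟶ X)
    (W V : E) (w : W ⟶ J) (p : V ⟶ W) (q : V ⟶ X) (e : V ⟶ Y) : Prop where
  cone : WSPCone P f g W V w p q e
  lift : ∀ ⦃W' V' : E⦄ (w' : W' ⟶ J) (p' : V' ⟶ W') (q' : V' ⟶ X) (e' : V' ⟶ Y),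
    WSPCone P f g W' V' w' p' q' e' →
    ∃ (α : W' ⟶ W) (β : V' ⟶ V),
      α ≫ w = w' ∧ β ≫ p = p' ≫ α ∧ β ≫ q = q' ∧ β ≫ e = e'

/-- `P` has weak simple products. -/
def HasWeakSimpleProducts (P : Set E) : Prop :=
  ∀ ⦃J Y X : E⦄, J ∈ P → Y ∈ P → X ∈ P → ∀ (f : Y ⟶ J) (g : Y ⟶ X),
    ∃ (W V : E) (w : W ⟶ J) (p : V ⟶ W) (q : V ⟶ X) (e : V ⟶ Y),
      IsWeakSimpleProduct P f g W V w p q e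

/-! ## Pseudo simple products -/

/-- A candidate diagram for a pseudo simple product (no determinacy requirement). -/
structure PSPCone (P : Set E) {J Y X : E} (f : Y ⟶ J) (g : Y ⟶ X)
    (W V : E) (w : W ⟶ J) (p : V ⟶ W) (q : V ⟶ X) (e : V ⟶ Y) : Prop where
  memW : W ∈ P
  wp : IsWeakProduct P p q
  comm₁ : p ≫ w = e ≫ f
  comm₂ : q = e ≫ g

/-- A pseudo simple product: a weakly terminal candidate diagram. -/
structure IsPseudoSimpleProduct (P : Set E) {J Y X : E} (f : Y ⟶ J) (g : Y ⟶ X)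
    (W V : E) (w : W ⟶ J) (p : V ⟶ W) (q : V ⟶ X) (e : V ⟶ Y) : Prop where
  cone : PSPCone P f g W V w p q e
  lift : ∀ ⦃W' V' : E⦄ (w' : W' ⟶ J) (p' : V' ⟶ W') (q' : V' ⟶ X) (e' : V' ⟶ Y),
    PSPCone P f g W' V' w' p' q' e' →
    ∃ (α : W' ⟶ W) (β : V' ⟶ V),
      α ≫ w = w' ∧ β ≫ p = p' ≫ α ∧ β ≫ q = q' ∧ β ≫ e = e'

/-- `P` has pseudo simple products. -/
def HasPseudoSimpleProducts (P : Set E) : Prop :=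
  ∀ ⦃J Y X : E⦄, J ∈ P → Y ∈ P → X ∈ P → ∀ (f : Y ⟶ J) (g : Y ⟶ X),
    ∃ (W V : E) (w : W ⟶ J) (p : V ⟶ W) (q : V ⟶ X) (e : V ⟶ Y),
      IsPseudoSimpleProduct P f g W V w p q e

/-! ## Weak exponentials -/

/-- A candidate diagram for a weak exponential of `X` and `Y`. -/
structure WExpCone (P : Set E) {X Y : E} (W V : E) (p : V ⟶ W) (q : V ⟶ X)
    (e : V ⟶ Y) : Prop where
  memW : W ∈ P
  wp : IsWeakProduct P p q
  det : DeterminedByProjections P p q e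

/-- A weak exponential of `X` and `Y` in `P`. -/
structure IsWeakExponential (P : Set E) {X Y : E} (W V : E) (p : V ⟶ W) (q : V ⟶ X)
    (e : V ⟶ Y) : Prop where
  cone : WExpCone P W V p q e
  lift : ∀ ⦃W' V' : E⦄ (p' : V' ⟶ W') (q' : V' ⟶ X) (e' : V' ⟶ Y),
    WExpCone P W' V' p' q' e' →
    ∃ (α : W' ⟶ W) (β : V' ⟶ V), β ≫ p = p' ≫ α ∧ β ≫ q = q' ∧ β ≫ e = e'

/-- `P` has weak exponentials. -/
def HasWeakExponentials (P : Set E) : Prop :=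
  ∀ ⦃X Y : E⦄, X ∈ P → Y ∈ P →
    ∃ (W V : E) (p : V ⟶ W) (q : V ⟶ X) (e : V ⟶ Y), IsWeakExponential P W V p q e

/-- A quasi exponential of `X` and `B`: the weak universal property of an exponential
restricted to projective sources. -/
def IsQuasiExponential [HasFiniteLimits E] (P : Set E) (X : E) {B : E} (W : E)
    (e : W ⨯ X ⟶ B) : Prop :=
  ∀ ⦃Z : E⦄, Z ∈ P → ∀ f : Z ⨯ X ⟶ B, ∃ g : Z ⟶ W, prod.map g (𝟙 X) ≫ e = f

section FinLim2
variable [HasFiniteLimits E]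

/-! ## Pseudo equivalence relations, equalities and generalised weak (simple) products -/

/-- A pseudo equivalence relation: a pair of parallel arrows whose image in `E` is an
equivalence relation. -/
def IsPseudoEquivRel {Y1 Y0 : E} (y₁ y₂ : Y1 ⟶ Y0) : Prop :=
  ∃ (R : E) (e : Y1 ⟶ R) (m : R ⟶ Y0 ⨯ Y0), RegEpi e ∧ Mono m ∧
    e ≫ m = prod.lift y₁ y₂ ∧ IsEquivRelPair (m ≫ prod.fst) (m ≫ prod.snd)

/-- An equality for a weak limit, relative to the comparison arrow `c : V0 ⟶ L` into
the actual limit: a pseudo equivalence relation `v₁, v₂ : V1 ⇉ V0` in `P` such that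
`c` is a coequaliser of `v₁, v₂` and `V1` regularly covers the kernel pair of `c`. -/
structure IsEqualityFor (P : Set E) {V1 V0 L : E} (c : V0 ⟶ L) (v₁ v₂ : V1 ⟶ V0) :
    Prop where
  mem : V1 ∈ P
  per : IsPseudoEquivRel v₁ v₂
  w : v₁ ≫ c = v₂ ≫ c
  coeq : Nonempty (IsColimit (Cofork.ofπ c w))
  cover : RegEpi (pullback.lift v₁ v₂ w)

/-- An arrow `e : V ⟶ Z0` out of a weak product with projections `p, q` preserves
projections with respect to a pseudo equivalence relation `z₁, z₂ : Z1 ⇉ Z0` if for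
any equality `v₁, v₂ : V1 ⇉ V` for the weak product there is `t : V1 ⟶ Z1` with
`t ≫ zᵢ = vᵢ ≫ e`. -/
def PreservesProjWP (P : Set E) {V X Y Z1 Z0 : E} (p : V ⟶ X) (q : V ⟶ Y)
    (z₁ z₂ : Z1 ⟶ Z0) (e : V ⟶ Z0) : Prop :=
  ∀ ⦃V1 : E⦄ (v₁ v₂ : V1 ⟶ V), IsEqualityFor P (prod.lift p q) v₁ v₂ →
    ∃ t : V1 ⟶ Z1, t ≫ z₁ = v₁ ≫ e ∧ t ≫ z₂ = v₂ ≫ e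

/-- A candidate diagram for a generalised weak simple product of `f` and `g` with
respect to the pseudo equivalence relation `y₁, y₂`. -/
structure GWSPCone (P : Set E) {Y1 Y0 J X : E} (y₁ y₂ : Y1 ⟶ Y0) (f : Y0 ⟶ J)
    (g : Y0 ⟶ X) (W V : E) (w : W ⟶ J) (p : V ⟶ W) (q : V ⟶ X) (e : V ⟶ Y0) :
    Prop where
  memW : W ∈ P
  wp : IsWeakProduct P p q
  pres : PreservesProjWP P p q y₁ y₂ e
  comm₁ : p ≫ w = e ≫ f
  comm₂ : q = e ≫ g

/-- A generalised weak simple product: a weakly terminal candidate diagram. -/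
structure IsGWSP (P : Set E) {Y1 Y0 J X : E} (y₁ y₂ : Y1 ⟶ Y0) (f : Y0 ⟶ J)
    (g : Y0 ⟶ X) (W V : E) (w : W ⟶ J) (p : V ⟶ W) (q : V ⟶ X) (e : V ⟶ Y0) :
    Prop where
  cone : GWSPCone P y₁ y₂ f g W V w p q e
  lift : ∀ ⦃W' V' : E⦄ (w' : W' ⟶ J) (p' : V' ⟶ W') (q' : V' ⟶ X) (e' : V' ⟶ Y0),
    GWSPCone P y₁ y₂ f g W' V' w' p' q' e' →
    ∃ (α : W' ⟶ W) (β : V' ⟶ V),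
      α ≫ w = w' ∧ β ≫ p = p' ≫ α ∧ β ≫ q = q' ∧ β ≫ e = e'

/-- `P` has generalised weak simple products. -/
def HasGWSP (P : Set E) : Prop :=
  ∀ ⦃Y1 Y0 J X : E⦄, Y1 ∈ P → Y0 ∈ P → J ∈ P → X ∈ P →
    ∀ (y₁ y₂ : Y1 ⟶ Y0), IsPseudoEquivRel y₁ y₂ →
    ∀ (f : Y0 ⟶ J) (g : Y0 ⟶ X), y₁ ≫ f = y₂ ≫ f → y₁ ≫ g = y₂ ≫ g →
    ∃ (W V : E) (w : W ⟶ J) (p : V ⟶ W) (q : V ⟶ X) (e : V ⟶ Y0),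
      IsGWSP P y₁ y₂ f g W V w p q e

/-- A candidate diagram for a generalised weak exponential of `X` and `y₁, y₂`. -/
structure GWExpCone (P : Set E) {X Y1 Y0 : E} (y₁ y₂ : Y1 ⟶ Y0)
    (W V : E) (p : V ⟶ W) (q : V ⟶ X) (e : V ⟶ Y0) : Prop where
  memW : W ∈ P
  wp : IsWeakProduct P p q
  pres : PreservesProjWP P p q y₁ y₂ e

/-- A generalised weak exponential of `X` and a pseudo equivalence relation. -/
structure IsGWExp (P : Set E) {X Y1 Y0 : E} (y₁ y₂ : Y1 ⟶ Y0)
    (W V : E) (p : V ⟶ W) (q : V ⟶ X) (e : V ⟶ Y0) : Prop where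
  cone : GWExpCone P y₁ y₂ W V p q e
  lift : ∀ ⦃W' V' : E⦄ (p' : V' ⟶ W') (q' : V' ⟶ X) (e' : V' ⟶ Y0),
    GWExpCone P y₁ y₂ W' V' p' q' e' →
    ∃ (α : W' ⟶ W) (β : V' ⟶ V), β ≫ p = p' ≫ α ∧ β ≫ q = q' ∧ β ≫ e = e'

/-! ## Weak pullbacks and generalised weak dependent products -/

/-- A weak pullback in `P` of the cospan `X →f J ←w W`. -/
structure IsWeakPullback (P : Set E) {X J W V : E} (f : X ⟶ J) (w : W ⟶ J)
    (a : V ⟶ X) (b : V ⟶ W) : Prop where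
  mem : V ∈ P
  comm : a ≫ f = b ≫ w
  lift : ∀ ⦃V' : E⦄, V' ∈ P → ∀ (a' : V' ⟶ X) (b' : V' ⟶ W), a' ≫ f = b' ≫ w →
    ∃ h : V' ⟶ V, h ≫ a = a' ∧ h ≫ b = b'

/-- Preservation of projections for an arrow out of a weak pullback. -/
def PreservesProjWPB (P : Set E) {V X J W Z1 Z0 : E} (f : X ⟶ J) (w : W ⟶ J)
    (a : V ⟶ X) (b : V ⟶ W) (h : a ≫ f = b ≫ w) (z₁ z₂ : Z1 ⟶ Z0) (e : V ⟶ Z0) :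
    Prop :=
  ∀ ⦃V1 : E⦄ (v₁ v₂ : V1 ⟶ V), IsEqualityFor P (pullback.lift a b h) v₁ v₂ →
    ∃ t : V1 ⟶ Z1, t ≫ z₁ = v₁ ≫ e ∧ t ≫ z₂ = v₂ ≫ e

/-- A candidate diagram for a generalised weak dependent product of `g : Y0 ⟶ X`
along `f : X ⟶ J` with respect to `y₁, y₂`. -/
structure GWDPCone (P : Set E) {Y1 Y0 X J : E} (y₁ y₂ : Y1 ⟶ Y0) (g : Y0 ⟶ X)
    (f : X ⟶ J) (W V : E) (w : W ⟶ J) (a : V ⟶ X) (b : V ⟶ W) (e : V ⟶ Y0) :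
    Prop where
  memW : W ∈ P
  comm : a ≫ f = b ≫ w
  wpb : IsWeakPullback P f w a b
  overX : e ≫ g = a
  pres : PreservesProjWPB P f w a b comm y₁ y₂ e

/-- A generalised weak dependent product: a weakly terminal candidate diagram. -/
structure IsGWDP (P : Set E) {Y1 Y0 X J : E} (y₁ y₂ : Y1 ⟶ Y0) (g : Y0 ⟶ X)
    (f : X ⟶ J) (W V : E) (w : W ⟶ J) (a : V ⟶ X) (b : V ⟶ W) (e : V ⟶ Y0) :
    Prop where
  cone : GWDPCone P y₁ y₂ g f W V w a b e
  lift : ∀ ⦃W' V' : E⦄ (w' : W' ⟶ J) (a' : V' ⟶ X) (b' : V' ⟶ W') (e' : V' ⟶ Y0),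
    GWDPCone P y₁ y₂ g f W' V' w' a' b' e' →
    ∃ (α : W' ⟶ W) (β : V' ⟶ V),
      α ≫ w = w' ∧ β ≫ a = a' ∧ β ≫ b = b' ≫ α ∧ β ≫ e = e'

/-- `P` has generalised weak dependent products (i.e. `P` is weakly locally cartesian
closed). -/
def HasGWDP (P : Set E) : Prop :=
  ∀ ⦃Y1 Y0 X J : E⦄, Y1 ∈ P → Y0 ∈ P → X ∈ P → J ∈ P →
    ∀ (y₁ y₂ : Y1 ⟶ Y0), IsPseudoEquivRel y₁ y₂ →
    ∀ (g : Y0 ⟶ X) (f : X ⟶ J), y₁ ≫ g = y₂ ≫ g →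
    ∃ (W V : E) (w : W ⟶ J) (a : V ⟶ X) (b : V ⟶ W) (e : V ⟶ Y0),
      IsGWDP P y₁ y₂ g f W V w a b e

/-! ## The functor `w_X` on subobjects induced by weak simple products -/

/-- The adjunction property of the weak-simple-product operation `w_X` on subobjects:
for every subobject `a : A ↪ J ⨯ X`, every `P`-cover `Y ↠ A`, every weak simple
product `W → J` of the induced span and every image factorisation `W ↠ I ↪ J` of it,
the subobject `I ↪ J` is a value at `a` of a right adjoint to
`(−) ⨯ X : Sub(J) → Sub(J ⨯ X)`. -/
def WAdj (P : Set E) (J X : E) : Prop :=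
  ∀ ⦃A : E⦄ (a : A ⟶ J ⨯ X), Mono a →
  ∀ ⦃Y : E⦄, Y ∈ P → ∀ (c : Y ⟶ A), RegEpi c →
  ∀ ⦃W V : E⦄ (w : W ⟶ J) (p : V ⟶ W) (q : V ⟶ X) (e : V ⟶ Y),
    IsWeakSimpleProduct P (c ≫ a ≫ prod.fst) (c ≫ a ≫ prod.snd) W V w p q e →
  ∀ ⦃I : E⦄ (ew : W ⟶ I) (m : I ⟶ J), RegEpi ew → Mono m → ew ≫ m = w →
  ∀ ⦃B : E⦄ (b : B ⟶ J), Mono b →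
    ((∃ t : B ⨯ X ⟶ A, t ≫ a = prod.map b (𝟙 X)) ↔ ∃ s : B ⟶ I, s ≫ m = b)

/-! ## Weak dependent products (à la Carboni–Rosolini) -/

/-- `P` has weak dependent products: for `f : X ⟶ J` and `g : Y ⟶ X` in `P` there are
`w : W ⟶ J` in `P` and a surjection `Hom_{P/J}(h, w) → Hom_{P/X}(f*(h), g)` natural
in `h ∈ P/J`. -/
def HasWeakDependentProducts (P : Set E) : Prop :=
  ∀ ⦃X J Y : E⦄, X ∈ P → J ∈ P → Y ∈ P → ∀ (f : X ⟶ J) (g : Y ⟶ X),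
    ∃ (W : E) (_ : W ∈ P) (w : W ⟶ J)
      (ε : ∀ ⦃T : E⦄, T ∈ P → ∀ (h : T ⟶ J) (k : T ⟶ W), k ≫ w = h →
        (pullback h f ⟶ Y)),
      (∀ ⦃T : E⦄ (hT : T ∈ P) (h : T ⟶ J) (k : T ⟶ W) (hk : k ≫ w = h),
         ε hT h k hk ≫ g = pullback.snd h f) ∧
      (∀ ⦃T : E⦄ (hT : T ∈ P) (h : T ⟶ J) (d : pullback h f ⟶ Y),
         d ≫ g = pullback.snd h f → ∃ (k : T ⟶ W) (hk : k ≫ w = h), ε hT h k hk = d) ∧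
      (∀ ⦃T' T : E⦄ (hT' : T' ∈ P) (hT : T ∈ P) (u : T' ⟶ T) (h : T ⟶ J) (k : T ⟶ W)
         (hk : k ≫ w = h),
         ε hT' (u ≫ h) (u ≫ k) (by rw [Category.assoc, hk]) =
           pullback.map (u ≫ h) f h f u (𝟙 X) (𝟙 J) (by simp) (by simp) ≫ ε hT h k hk)


/-! ## Auxiliary lemmas -/

section Aux

attribute [local simp] pullback.lift_fst pullback.lift_snd pullback.lift_fst_assoc
  pullback.lift_snd_assoc

lemma RegEpi.epi' {A B : E} {f : A ⟶ B} (h : RegEpi f) : Epi f :=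
  let ⟨r⟩ := h
  RegularEpi.epi f r

lemma RegEpi.isRegularEpi {A B : E} {f : A ⟶ B} (h : RegEpi f) : IsRegularEpi f := ⟨h⟩

lemma RegEpi.descend {A B C : E} {f : A ⟶ B} (h : RegEpi f) (k : A ⟶ C)
    (hk : ∀ ⦃T : E⦄ (a b : T ⟶ A), a ≫ f = b ≫ f → a ≫ k = b ≫ k) :
    ∃ l : B ⟶ C, f ≫ l = k := by
  obtain ⟨r⟩ := h
  obtain ⟨l, hl⟩ := RegularEpi.desc' r k (hk _ _ r.w)
  exact ⟨l, hl⟩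

lemma RegEpi.cancel {A B C : E} {f : A ⟶ B} (h : RegEpi f) {k l : B ⟶ C}
    (hk : f ≫ k = f ≫ l) : k = l := by
  have := h.epi'
  exact (cancel_epi f).1 hk

/-- Orthogonality of regular epis and monos. -/
lemma RegEpi.diag {A B C D : E} {e : A ⟶ B} (h : RegEpi e) {m : C ⟶ D} (hm : Mono m)
    (a : A ⟶ C) (b : B ⟶ D) (w : a ≫ m = e ≫ b) : ∃ s : B ⟶ C, s ≫ m = b := by
  obtain ⟨l, hl⟩ := h.descend a (fun T x y hxy => by
    rw [← cancel_mono m]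
    simp only [Category.assoc, w]
    rw [← Category.assoc, hxy, Category.assoc])
  refine ⟨l, h.cancel ?_⟩
  rw [← Category.assoc, hl, w]

variable [HasFiniteLimits E]

lemma IsExact.local_lift (hE : IsExact E) {T' T Z : E} {v : T' ⟶ T} (hv : RegEpi v)
    (z : Z ⟶ T) : ∃ (Z' : E) (e : Z' ⟶ Z) (z' : Z' ⟶ T'), RegEpi e ∧ z' ≫ v = e ≫ z :=
  ⟨pullback v z, pullback.snd v z, pullback.fst v z, hE.stable v z hv, pullback.condition⟩

lemma IsExact.regEpi_of_local (hE : IsExact E) {A B Z : E} {n : A ⟶ B} {e : Z ⟶ B}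
    (he : RegEpi e) (z : Z ⟶ A) (h : z ≫ n = e) : RegEpi n := by
  obtain ⟨I, e', m, he', hm, hf⟩ := hE.factor n
  obtain ⟨s, hs⟩ := he.diag hm (z ≫ e') (𝟙 B) (by simp [hf, h])
  have : IsIso m := ⟨s, by rw [← cancel_mono m]; simp [hs], hs⟩
  obtain ⟨r⟩ := he'
  have i : Arrow.mk e' ≅ Arrow.mk n :=
    Arrow.isoMk (f := Arrow.mk e') (g := Arrow.mk n) (Iso.refl A) (asIso m) (by simp [hf])
  exact ⟨RegularEpi.ofArrowIso i r⟩

/-- Covering a pullback by a projective. -/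
lemma exists_cover (hE : IsExact E) (hEP : EnoughRegProjectives E) {A B C : E}
    (j : A ⟶ C) (p : B ⟶ C) :
    ∃ (X : E) (f : X ⟶ A) (x : X ⟶ B), RegProjective X ∧ f ≫ j = x ≫ p ∧
      (∀ ⦃Z : E⦄ (z : Z ⟶ A) (r : Z ⟶ B), z ≫ j = r ≫ p →
        ∃ (Z' : E) (e' : Z' ⟶ Z) (z' : Z' ⟶ X), RegEpi e' ∧ z' ≫ f = e' ≫ z ∧
          z' ≫ x = e' ≫ r) ∧
      (∀ ⦃Z : E⦄ (z : Z ⟶ A) (r : Z ⟶ B), RegProjective Z → z ≫ j = r ≫ p →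
        ∃ (z' : Z ⟶ X), z' ≫ f = z ∧ z' ≫ x = r) := by
  obtain ⟨X, c, hX, hc⟩ := hEP (pullback j p)
  refine ⟨X, c ≫ pullback.fst _ _, c ≫ pullback.snd _ _, hX, ?_, ?_, ?_⟩
  · simp [pullback.condition]
  · intro Z z r h
    obtain ⟨Z', e', z', he', hz'⟩ := hE.local_lift hc (pullback.lift z r h)
    exact ⟨Z', e', z', he', by simp [reassoc_of% hz'], by simp [reassoc_of% hz']⟩
  · intro Z z r hZ h
    obtain ⟨z', hz'⟩ := hZ c hc (pullback.lift z r h)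
    exact ⟨z', by simp [reassoc_of% hz'], by simp [reassoc_of% hz']⟩

/-- The locus where two maps agree along the fibres of `π`. -/
def Agree {A B G T : E} (π : A ⟶ B) (a b : A ⟶ G) (t : T ⟶ B) : Prop :=
  ∀ ⦃Z : E⦄ (z : Z ⟶ T) (y : Z ⟶ A), z ≫ t = y ≫ π → y ≫ a = y ≫ b

lemma Agree.precomp {A B G T T' : E} {π : A ⟶ B} {a b : A ⟶ G} {t : T ⟶ B}
    (h : Agree π a b t) (u : T' ⟶ T) : Agree π a b (u ≫ t) :=
  fun _ z y e => h (z ≫ u) y (by simpa using e)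

lemma IsExact.agree_local (hE : IsExact E) {A B G T T' : E} {π : A ⟶ B} {a b : A ⟶ G}
    {t : T ⟶ B} {u : T' ⟶ T} (hu : RegEpi u) (h : Agree π a b (u ≫ t)) : Agree π a b t := by
  intro Z z y e
  obtain ⟨Z', e', z', he', hz'⟩ := hE.local_lift hu z
  refine he'.cancel ?_
  have := h z' (e' ≫ y) (by rw [← Category.assoc, hz']; simp [e])
  simpa using this

lemma exists_agree (hE : IsExact E) (hEP : EnoughRegProjectives E)
    (hclosed : ∀ ⦃X Y Z : E⦄ (f : X ⟶ Z) (g : Y ⟶ Z), RegProjective X →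
      RegProjective Y → RegProjective Z → RegProjective (pullback f g))
    (hW : HasWeakDependentProducts {X : E | RegProjective X})
    {A B G : E} (π : A ⟶ B) (a b : A ⟶ G) :
    ∃ (U : E) (m : U ⟶ B), Mono m ∧
      ∀ ⦃T : E⦄ (t : T ⟶ B), Agree π a b t ↔ ∃ s : T ⟶ U, s ≫ m = t := by
  obtain ⟨J, j, hJ, hj⟩ := hEP B
  obtain ⟨X, f, x, hX, hfx, hloc, -⟩ := exists_cover hE hEP j π
  obtain ⟨Y, y, hY, hy⟩ := hEP (equalizer (x ≫ a) (x ≫ b))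
  obtain ⟨W, hWP, w, ε, hε₁, hε₂, -⟩ := hW hX hJ hY f (y ≫ equalizer.ι _ _)
  obtain ⟨U, e, m, he, hm, hem⟩ := hE.factor (w ≫ j)
  have good : Agree π a b (w ≫ j) := by
    intro Z z p hp
    obtain ⟨Z', e', z', he', hz1, hz2⟩ := hloc (z ≫ w) p (by simpa using hp)
    refine he'.cancel ?_
    have h1 : (e' ≫ z) ≫ w = z' ≫ f := by simp [hz1]
    have h2 : e' ≫ p = z' ≫ x := hz2.symm
    let d := pullback.lift (e' ≫ z) z' h1 ≫ ε hWP w (𝟙 W) (by simp)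
    have h3 : d ≫ y ≫ equalizer.ι (x ≫ a) (x ≫ b) = z' := by
      simp only [d, Category.assoc]
      rw [hε₁]; simp
    rw [← Category.assoc, ← Category.assoc, h2, ← h3]
    simp only [Category.assoc]
    rw [equalizer.condition]
  refine ⟨U, m, hm, fun T t => ⟨fun ht => ?_, ?_⟩⟩
  · obtain ⟨T', v, hT', hv⟩ := hEP T
    obtain ⟨t', ht'⟩ := hT' j hj (v ≫ t)
    have hP := hclosed t' f hT' hX hJ
    have hz : pullback.snd t' f ≫ x ≫ a = pullback.snd t' f ≫ x ≫ b := by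
      have := ht (pullback.fst t' f ≫ v) (pullback.snd t' f ≫ x) (by
        rw [Category.assoc, Category.assoc, ← ht', ← hfx, pullback.condition_assoc])
      simpa using this
    obtain ⟨d, hd⟩ := hP y hy (equalizer.lift (pullback.snd t' f) hz)
    obtain ⟨k, hk, -⟩ := hε₂ hT' t' d (by rw [← Category.assoc, hd]; simp)
    exact hv.diag hm (k ≫ e) t (by rw [Category.assoc, hem, ← Category.assoc, hk, ht'])
  · rintro ⟨s, rfl⟩
    apply Agree.precomp
    apply hE.agree_local he
    rwa [hem]

/-- Weak exponentials (relative to projectives). -/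
lemma exists_weak_exp (hE : IsExact E) (hEP : EnoughRegProjectives E)
    (hclosed : ∀ ⦃X Y Z : E⦄ (f : X ⟶ Z) (g : Y ⟶ Z), RegProjective X →
      RegProjective Y → RegProjective Z → RegProjective (pullback f g))
    (hW : HasWeakDependentProducts {X : E | RegProjective X})
    {F G I : E} (p : F ⟶ I) (q : G ⟶ I) :
    ∃ (W : E) (w : W ⟶ I) (φ : pullback w p ⟶ G), φ ≫ q = pullback.fst w p ≫ w ∧
      ∀ ⦃T : E⦄ (t : T ⟶ I) (d : pullback t p ⟶ G), RegProjective T →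
        d ≫ q = pullback.fst t p ≫ t →
        ∃ u : T ⟶ W, u ≫ w = t ∧ ∀ ⦃Z : E⦄ (z : Z ⟶ T) (y : Z ⟶ F) (h : z ≫ t = y ≫ p)
          (h' : (z ≫ u) ≫ w = y ≫ p),
          pullback.lift (z ≫ u) y h' ≫ φ = pullback.lift z y h ≫ d := by
  obtain ⟨J, j, hJ, hj⟩ := hEP I
  obtain ⟨X, f, x, hX, hfx, hloc, -⟩ := exists_cover hE hEP j p
  obtain ⟨Y, g, γ, hY, hgγ, -, hYlift⟩ := exists_cover hE hEP (f ≫ j) q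
  obtain ⟨W, hWP, w, ε, hε₁, hε₂, hε₃⟩ := hW hX hJ hY f g
  obtain ⟨e, he⟩ : ∃ e, e = ε hWP w (𝟙 W) (by simp) := ⟨_, rfl⟩
  have heg : e ≫ g = pullback.snd w f := he ▸ hε₁ _ _ _ _
  -- naturality
  have hnat : ∀ ⦃T : E⦄ (hT : RegProjective T) (t : T ⟶ J) (k : T ⟶ W) (hk : k ≫ w = t)
      ⦃Z : E⦄ (z : Z ⟶ T) (r : Z ⟶ X) (h : z ≫ t = r ≫ f) (h' : (z ≫ k) ≫ w = r ≫ f),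
      pullback.lift z r h ≫ ε hT t k hk = pullback.lift (z ≫ k) r h' ≫ e := by
    intro T hT t k hk Z z r h h'
    subst hk
    have h1 := hε₃ hT hWP k w (𝟙 W) (by simp)
    have h2 : ∀ (k' : T ⟶ W) (_ : k' = k) (hk' : k' ≫ w = k ≫ w),
        ε hT (k ≫ w) k' hk' = ε hT (k ≫ w) k rfl := by
      intro k' h2 _; subst h2; rfl
    rw [h2 _ (by simp)] at h1
    rw [h1, ← he, ← Category.assoc]
    congr 1
    apply pullback.hom_ext <;> simp
  -- the locus
  obtain ⟨n, hn_fst, hn_snd⟩ : ∃ n : pullback w f ⟶ pullback (w ≫ j) p,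
      n ≫ pullback.fst _ _ = pullback.fst _ _ ∧
      n ≫ pullback.snd _ _ = pullback.snd _ _ ≫ x :=
    ⟨pullback.lift (pullback.fst _ _) (pullback.snd _ _ ≫ x) (by
      rw [pullback.condition_assoc, hfx, Category.assoc]), by simp, by simp⟩
  obtain ⟨W1, m, hm, hW1⟩ := exists_agree hE hEP hclosed hW
    (pullback.fst n n ≫ n ≫ pullback.fst _ _) (pullback.fst n n ≫ e ≫ γ)
    (pullback.snd n n ≫ e ≫ γ)
  have hgood := (hW1 m).2 ⟨𝟙 _, by simp⟩
  -- elementwise form of the agreement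
  have hel : ∀ ⦃Z : E⦄ (s : Z ⟶ W1) (r r' : Z ⟶ X) (h : (s ≫ m) ≫ w = r ≫ f)
      (h' : (s ≫ m) ≫ w = r' ≫ f), r ≫ x = r' ≫ x →
      pullback.lift _ _ h ≫ e ≫ γ = pullback.lift _ _ h' ≫ e ≫ γ := by
    intro Z s r r' h h' hr
    have := hgood s (pullback.lift (pullback.lift _ _ h) (pullback.lift _ _ h') (by
      apply pullback.hom_ext <;> simp [hn_fst, hn_snd, hr])) (by simp [hn_fst])
    simpa using this
  have hc1 := pullback.condition (f := m ≫ w) (g := f)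
  obtain ⟨w1, hw1⟩ : ∃ w1 : W1 ⟶ I, w1 = m ≫ w ≫ j := ⟨_, rfl⟩
  obtain ⟨n1, hn1_fst, hn1_snd⟩ : ∃ n1 : pullback (m ≫ w) f ⟶ pullback w1 p,
      n1 ≫ pullback.fst _ _ = pullback.fst _ _ ∧
      n1 ≫ pullback.snd _ _ = pullback.snd _ _ ≫ x :=
    ⟨pullback.lift (pullback.fst _ _) (pullback.snd _ _ ≫ x) (by
      rw [hw1, Category.assoc, ← hfx, reassoc_of% hc1]), by simp, by simp⟩
  have hn1 : RegEpi n1 := by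
    obtain ⟨Z', e', z', he', hz1, hz2⟩ := hloc (pullback.fst w1 p ≫ m ≫ w)
      (pullback.snd w1 p) (by
        have := pullback.condition (f := w1) (g := p)
        rw [← this, hw1]; simp)
    refine hE.regEpi_of_local he' (pullback.lift (e' ≫ pullback.fst _ _) z' ?_) ?_
    · simp [hz1]
    · apply pullback.hom_ext
      · rw [Category.assoc, hn1_fst]; simp
      · rw [Category.assoc, hn1_snd]; simp [hz2]
  obtain ⟨e1, he1_fst, he1_snd⟩ : ∃ e1 : pullback (m ≫ w) f ⟶ pullback w f,
      e1 ≫ pullback.fst _ _ = pullback.fst _ _ ≫ m ∧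
      e1 ≫ pullback.snd _ _ = pullback.snd _ _ :=
    ⟨pullback.lift (pullback.fst _ _ ≫ m) (pullback.snd _ _) (by simpa using hc1),
      by simp, by simp⟩
  obtain ⟨φ, hφ⟩ := hn1.descend (e1 ≫ e ≫ γ) (by
    intro T α β hαβ
    have h1 : α ≫ pullback.fst _ _ = β ≫ pullback.fst _ _ := by
      have := congrArg (fun s => s ≫ pullback.fst _ _) hαβ
      simpa [hn1_fst, hn1_snd] using this
    have h2 : α ≫ pullback.snd _ _ ≫ x = β ≫ pullback.snd _ _ ≫ x := by
      have := congrArg (fun s => s ≫ pullback.snd _ _) hαβ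
      simpa [hn1_fst, hn1_snd] using this
    have cα := α ≫= pullback.condition (f := m ≫ w) (g := f)
    have cβ := β ≫= pullback.condition (f := m ≫ w) (g := f)
    rw [← Category.assoc β, ← h1] at cβ
    have := hel (α ≫ pullback.fst _ _) (α ≫ pullback.snd _ _) (β ≫ pullback.snd _ _)
      (by simpa using cα) (by simpa using cβ) (by simpa using h2)
    convert this using 1
    · rw [← Category.assoc]; congr 1; apply pullback.hom_ext <;> simp [he1_fst, he1_snd]
    · rw [← Category.assoc]; congr 1; apply pullback.hom_ext <;> simp [he1_fst, he1_snd, reassoc_of% h1])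
  refine ⟨W1, w1, φ, ?_, ?_⟩
  · refine hn1.cancel ?_
    rw [← Category.assoc, hφ]
    simp only [Category.assoc]
    rw [← hgγ, reassoc_of% heg, reassoc_of% he1_snd, reassoc_of% hn1_fst, hw1,
      reassoc_of% hc1]
  · intro T t d hT hd
    obtain ⟨t', ht'⟩ := hT j hj t
    have hP := hclosed t' f hT hX hJ
    have hcond : pullback.fst t' f ≫ t = (pullback.snd t' f ≫ x) ≫ p := by
      rw [← ht', pullback.condition_assoc, hfx, Category.assoc]
    obtain ⟨d', hd'g, hd'γ⟩ := hYlift (pullback.snd t' f)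
      (pullback.lift (pullback.fst t' f) (pullback.snd t' f ≫ x) hcond ≫ d) hP (by
        rw [Category.assoc, hd, pullback.lift_fst_assoc, ← ht', pullback.condition_assoc])
    obtain ⟨k, hk, hkd⟩ := hε₂ hT t' d' hd'g
    -- computing on elements
    have hcomp : ∀ ⦃Z : E⦄ (z : Z ⟶ T) (r : Z ⟶ X) (h : (z ≫ k) ≫ w = r ≫ f)
        (h' : z ≫ t = (r ≫ x) ≫ p),
        pullback.lift (z ≫ k) r h ≫ e ≫ γ = pullback.lift z (r ≫ x) h' ≫ d := by
      intro Z z r h h'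
      have h0 : z ≫ t' = r ≫ f := by rw [← h, ← hk]; simp
      have := hnat hT t' k hk z r h0 h
      rw [hkd] at this
      rw [← reassoc_of% this, hd'γ, ← Category.assoc]
      congr 1
      apply pullback.hom_ext <;> simp
    have hag : ∃ s : T ⟶ W1, s ≫ m = k := by
      rw [← hW1]
      intro Z z r hzr
      have hnn := r ≫= pullback.condition (f := n) (g := n)
      have hA : (r ≫ pullback.fst n n) ≫ pullback.fst w f = z ≫ k := by
        rw [hzr]; simp [hn_fst]
      have hB : (r ≫ pullback.snd n n) ≫ pullback.fst w f = z ≫ k := by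
        rw [hzr]
        have := hnn =≫ pullback.fst _ _
        simp only [Category.assoc, hn_fst] at this ⊢
        exact this.symm
      have hx : ((r ≫ pullback.fst n n) ≫ pullback.snd w f) ≫ x
          = ((r ≫ pullback.snd n n) ≫ pullback.snd w f) ≫ x := by
        have := hnn =≫ pullback.snd _ _
        simpa only [Category.assoc, hn_snd] using this
      rw [← Category.assoc r, ← Category.assoc r]
      generalize r ≫ pullback.fst n n = r1 at *
      generalize r ≫ pullback.snd n n = r2 at *
      have key : ∀ r1 : Z ⟶ pullback w f, r1 ≫ pullback.fst w f = z ≫ k →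
          ∃ h' : z ≫ t = ((r1 ≫ pullback.snd w f) ≫ x) ≫ p,
            r1 ≫ e ≫ γ = pullback.lift z ((r1 ≫ pullback.snd w f) ≫ x) h' ≫ d := by
        intro r1 hA
        have c1 : (z ≫ k) ≫ w = (r1 ≫ pullback.snd w f) ≫ f := by
          rw [← hA]; simp [pullback.condition]
        have h' : z ≫ t = ((r1 ≫ pullback.snd w f) ≫ x) ≫ p := by
          rw [Category.assoc _ x, ← hfx, ← Category.assoc _ f, ← c1]; simp [reassoc_of% hk, ht']
        refine ⟨h', ?_⟩
        rw [← hcomp z _ c1 h']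
        congr 1
        apply pullback.hom_ext <;> simp [hA]
      obtain ⟨h1, e1⟩ := key r1 hA
      obtain ⟨h2, e2⟩ := key r2 hB
      rw [e1, e2]
      congr 1
      apply pullback.hom_ext <;> simp only [pullback.lift_fst, pullback.lift_snd, hx]
    obtain ⟨s, hs⟩ := hag
    refine ⟨s, by rw [hw1, reassoc_of% hs, reassoc_of% hk, ht'], ?_⟩
    intro Z z r h h'
    obtain ⟨Z', e', z', he', hz1, hz2⟩ := hloc (z ≫ t') r (by simp [ht', h])
    refine he'.cancel ?_
    have h3 : ((e' ≫ z) ≫ k) ≫ w = z' ≫ f := by simp [hz1, hk]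
    have := hcomp (e' ≫ z) z' h3 (by simp [hz2, h])
    have h4 : e' ≫ pullback.lift z r h = pullback.lift (e' ≫ z) (z' ≫ x) (by simp [hz2, h]) := by
      apply pullback.hom_ext <;> simp [hz2]
    rw [reassoc_of% h4, ← this]
    have h5 : e' ≫ pullback.lift (z ≫ s) r h'
        = pullback.lift (e' ≫ z ≫ s) z' (by simp [reassoc_of% hs, hz1, hk]) ≫ n1 := by
      apply pullback.hom_ext <;> simp [hn1_fst, hn1_snd, hz2]
    rw [reassoc_of% h5, hφ, ← Category.assoc]
    congr 1
    apply pullback.hom_ext <;> simp [he1_fst, he1_snd, hs]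

/-- Dependent exponential of `q` by `p`. -/
def HasExp {F G I : E} (p : F ⟶ I) (q : G ⟶ I) : Prop :=
  ∃ (R : E) (r : R ⟶ I) (φ : pullback r p ⟶ G), φ ≫ q = pullback.fst r p ≫ r ∧
    ∀ ⦃T : E⦄ (t : T ⟶ I) (d : pullback t p ⟶ G), d ≫ q = pullback.fst t p ≫ t →
      ∃! u : T ⟶ R, u ≫ r = t ∧ ∀ ⦃Z : E⦄ (z : Z ⟶ T) (y : Z ⟶ F) (h : z ≫ t = y ≫ p)
        (h' : (z ≫ u) ≫ r = y ≫ p),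
        pullback.lift (z ≫ u) y h' ≫ φ = pullback.lift z y h ≫ d

lemma exists_exp (hE : IsExact E) (hEP : EnoughRegProjectives E)
    (hclosed : ∀ ⦃X Y Z : E⦄ (f : X ⟶ Z) (g : Y ⟶ Z), RegProjective X →
      RegProjective Y → RegProjective Z → RegProjective (pullback f g))
    (hW : HasWeakDependentProducts {X : E | RegProjective X})
    {F G I : E} (p : F ⟶ I) (q : G ⟶ I) : HasExp p q := by
  obtain ⟨W, w, φ, hφ, hlift⟩ := exists_weak_exp hE hEP hclosed hW p q
  have hDc := pullback.condition (f := w) (g := w)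
  have hAc := pullback.condition (f := pullback.fst w w ≫ w) (g := p)
  obtain ⟨D, δ₁, δ₂, hδ, hDl, hDe⟩ : ∃ (D : E) (δ₁ δ₂ : D ⟶ W), δ₁ ≫ w = δ₂ ≫ w ∧
      (∀ ⦃T : E⦄ (k k' : T ⟶ W), k ≫ w = k' ≫ w → ∃ l : T ⟶ D, l ≫ δ₁ = k ∧ l ≫ δ₂ = k') ∧
      (∀ ⦃T : E⦄ (l l' : T ⟶ D), l ≫ δ₁ = l' ≫ δ₁ → l ≫ δ₂ = l' ≫ δ₂ → l = l') :=
    ⟨pullback w w, pullback.fst _ _, pullback.snd _ _, pullback.condition,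
      fun T k k' h => ⟨pullback.lift k k' h, by simp, by simp⟩,
      fun T l l' h h' => pullback.hom_ext h h'⟩
  have hAc := pullback.condition (f := δ₁ ≫ w) (g := p)
  obtain ⟨R, m, hm, hR⟩ := exists_agree hE hEP hclosed hW (pullback.fst (δ₁ ≫ w) p)
    (pullback.lift (pullback.fst (δ₁ ≫ w) p ≫ δ₁) (pullback.snd (δ₁ ≫ w) p)
      (by simpa using hAc) ≫ φ)
    (pullback.lift (pullback.fst (δ₁ ≫ w) p ≫ δ₂) (pullback.snd (δ₁ ≫ w) p)
      (by simpa [hδ] using hAc) ≫ φ)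
  -- elementwise characterisation of `R`
  have hR1 : ∀ ⦃T : E⦄ (s : T ⟶ R) (y : T ⟶ F) (h : (s ≫ m ≫ δ₁) ≫ w = y ≫ p)
      (h' : (s ≫ m ≫ δ₂) ≫ w = y ≫ p),
      pullback.lift _ _ h ≫ φ = pullback.lift _ _ h' ≫ φ := by
    intro T s y h h'
    have := (hR (s ≫ m)).2 ⟨s, rfl⟩ (𝟙 T) (pullback.lift (s ≫ m) y (by simpa using h)) (by simp)
    simp only [← Category.assoc] at this
    convert this using 2
    · apply pullback.hom_ext <;> simp
    · apply pullback.hom_ext <;> simp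
  have hR2 : ∀ ⦃T : E⦄ (k k' : T ⟶ W), k ≫ w = k' ≫ w →
      (∀ ⦃Z : E⦄ (z : Z ⟶ T) (y : Z ⟶ F) (h : (z ≫ k) ≫ w = y ≫ p)
        (h' : (z ≫ k') ≫ w = y ≫ p),
        pullback.lift _ _ h ≫ φ = pullback.lift _ _ h' ≫ φ) →
      ∃ s : T ⟶ R, s ≫ m ≫ δ₁ = k ∧ s ≫ m ≫ δ₂ = k' := by
    intro T k k' hkk hZ
    obtain ⟨l, hl1, hl2⟩ := hDl k k' hkk
    obtain ⟨s, hs⟩ := (hR l).1 (by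
      intro Z z y hzy
      have c1 : (z ≫ k) ≫ w = (y ≫ pullback.snd _ _) ≫ p := by
        rw [Category.assoc, Category.assoc, ← hAc, ← reassoc_of% hzy, reassoc_of% hl1]
      have c2 : (z ≫ k') ≫ w = (y ≫ pullback.snd _ _) ≫ p := by
        rw [← c1]; simp [hkk]
      have := hZ z (y ≫ pullback.snd _ _) c1 c2
      simp only [← Category.assoc]
      convert this using 2
      · apply pullback.hom_ext <;> simp [← hl1, reassoc_of% hzy]
      · apply pullback.hom_ext <;> simp [← hl2, reassoc_of% hzy])
    exact ⟨s, by rw [reassoc_of% hs, hl1], by rw [reassoc_of% hs, hl2]⟩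
  have hrw : (m ≫ δ₁) ≫ w = (m ≫ δ₂) ≫ w := by simp [hδ]
  have heq : IsEquivRelPair (m ≫ δ₁) (m ≫ δ₂) := by
    refine ⟨?_, ?_, ?_, ?_⟩
    · intro T h k h1 h2
      rw [← cancel_mono m]
      exact hDe _ _ (by simpa using h1) (by simpa using h2)
    · exact hR2 _ _ rfl (fun Z z y h h' => rfl)
    · refine hR2 _ _ hrw.symm (fun Z z y h h' => ?_)
      exact (hR1 z y h' h).symm
    · intro T a b hab
      refine hR2 _ _ ?_ (fun Z z y h h' => ?_)
      · have e1 := a ≫= hrw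
        have e2 := b ≫= hrw
        have e3 := hab =≫ w
        simp only [Category.assoc] at e1 e2 e3 ⊢
        rw [e1, e3, e2]
      · have c1 : ((z ≫ a) ≫ m ≫ δ₂) ≫ w = y ≫ p := by
          rw [← h]; simp [hδ]
        have c2 : ((z ≫ b) ≫ m ≫ δ₁) ≫ w = y ≫ p := by
          rw [← h']; simp [hδ]
        have e1 := hR1 (z ≫ a) y (by simpa using h) c1
        have e2 := hR1 (z ≫ b) y c2 (by simpa using h')
        have e3 : pullback.lift _ _ c1 = pullback.lift _ _ c2 := by
          apply pullback.hom_ext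
          · simpa using z ≫= hab
          · simp
        rw [e3] at e1
        have e4 := e1.trans e2
        convert e4 using 2
        · apply pullback.hom_ext <;> simp
        · apply pullback.hom_ext <;> simp
  obtain ⟨Q, π, hπ, ⟨hcol⟩, hpb⟩ := hE.effective _ _ heq
  have hπe : RegEpi π := ⟨⟨R, _, _, hπ, hcol⟩⟩
  have hker : ∀ ⦃T : E⦄ (k k' : T ⟶ W), k ≫ π = k' ≫ π →
      ∃ s : T ⟶ R, s ≫ m ≫ δ₁ = k ∧ s ≫ m ≫ δ₂ = k' := fun T k k' h =>
    ⟨hpb.lift k k' h, hpb.lift_fst _ _ _, hpb.lift_snd _ _ _⟩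
  obtain ⟨wQ, hwQ⟩ := hπe.descend w (by
    intro T k k' h
    obtain ⟨s, rfl, rfl⟩ := hker k k' h
    simp [hδ])
  obtain ⟨n, hn_fst, hn_snd⟩ : ∃ n : pullback w p ⟶ pullback wQ p,
      n ≫ pullback.fst _ _ = pullback.fst _ _ ≫ π ∧ n ≫ pullback.snd _ _ = pullback.snd _ _ :=
    ⟨pullback.lift (pullback.fst _ _ ≫ π) (pullback.snd _ _) (by
      rw [Category.assoc, hwQ, pullback.condition]), by simp, by simp⟩
  have hn : RegEpi n := by
    obtain ⟨Z', e', z', he', hz'⟩ := hE.local_lift hπe (pullback.fst wQ p)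
    refine hE.regEpi_of_local he' (pullback.lift z' (e' ≫ pullback.snd _ _) ?_) ?_
    · rw [← hwQ, reassoc_of% hz', pullback.condition, Category.assoc]
    · apply pullback.hom_ext
      · rw [Category.assoc, hn_fst]; simp [hz']
      · rw [Category.assoc, hn_snd]; simp
  obtain ⟨φQ, hφQ⟩ := hn.descend φ (by
    intro T a b hab
    have h1 : (a ≫ pullback.fst _ _) ≫ π = (b ≫ pullback.fst _ _) ≫ π := by
      have := hab =≫ pullback.fst _ _
      simpa [hn_fst] using this
    have h2 : a ≫ pullback.snd _ _ = b ≫ pullback.snd _ _ := by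
      have := hab =≫ pullback.snd _ _
      simpa [hn_snd] using this
    obtain ⟨s, hs1, hs2⟩ := hker _ _ h1
    have c1 : (s ≫ m ≫ δ₁) ≫ w = (a ≫ pullback.snd _ _) ≫ p := by
      rw [hs1]; simp [pullback.condition]
    have c2 : (s ≫ m ≫ δ₂) ≫ w = (a ≫ pullback.snd _ _) ≫ p := by
      rw [hs2, h2]; simp [pullback.condition]
    have := hR1 s _ c1 c2
    convert this using 2
    · apply pullback.hom_ext
      · rw [pullback.lift_fst, hs1]
      · simp
    · apply pullback.hom_ext
      · rw [pullback.lift_fst, hs2]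
      · simp [h2])
  -- evaluation of `φQ`
  have hev : ∀ ⦃Z : E⦄ (k : Z ⟶ W) (u : Z ⟶ Q) (y : Z ⟶ F) (h : k ≫ w = y ≫ p)
      (h' : u ≫ wQ = y ≫ p), k ≫ π = u → pullback.lift u y h' ≫ φQ = pullback.lift k y h ≫ φ := by
    rintro Z k u y h h' rfl
    rw [← hφQ, ← Category.assoc]
    congr 1
    apply pullback.hom_ext
    · rw [Category.assoc, hn_fst]; simp
    · rw [Category.assoc, hn_snd]; simp
  refine ⟨Q, wQ, φQ, ?_, ?_⟩
  · refine hn.cancel ?_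
    rw [reassoc_of% hφQ, hφ, reassoc_of% hn_fst, hwQ]
  · intro T t d hd
    apply existsUnique_of_exists_of_unique
    · obtain ⟨T', v, hT', hv⟩ := hEP T
      have cv := pullback.condition (f := v ≫ t) (g := p)
      obtain ⟨k, hk, hkd⟩ := hlift (v ≫ t)
        (pullback.lift (pullback.fst _ _ ≫ v) (pullback.snd _ _) (by simpa using cv) ≫ d) hT'
        (by rw [Category.assoc, hd]; simp)
      have hkd' : ∀ ⦃Z : E⦄ (z : Z ⟶ T') (y : Z ⟶ F) (h : (z ≫ v) ≫ t = y ≫ p)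
          (h' : (z ≫ k) ≫ w = y ≫ p),
          pullback.lift (z ≫ k) y h' ≫ φ = pullback.lift (z ≫ v) y h ≫ d := by
        intro Z z y h h'
        rw [hkd z y (by simpa using h) h', ← Category.assoc]
        congr 1
        apply pullback.hom_ext <;> simp
      obtain ⟨u, hu⟩ := hv.descend (k ≫ π) (by
        intro Z a b hab
        obtain ⟨s, hs1, hs2⟩ := hR2 (a ≫ k) (b ≫ k)
          (by rw [Category.assoc, hk, Category.assoc, hk, reassoc_of% hab]) (by
            intro Z' z y h h'
            have c1 : ((z ≫ a) ≫ v) ≫ t = y ≫ p := by rw [← h]; simp [hk]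
            have c2 : ((z ≫ b) ≫ v) ≫ t = y ≫ p := by rw [← h']; simp [hk]
            have e1 := hkd' (z ≫ a) y c1 (by simpa using h)
            have e2 := hkd' (z ≫ b) y c2 (by simpa using h')
            have e3 : pullback.lift _ _ c1 = pullback.lift _ _ c2 := by
              apply pullback.hom_ext
              · simpa using z ≫= hab
              · simp
            rw [e3, ← e2] at e1
            convert e1 using 2
            · apply pullback.hom_ext <;> simp
            · apply pullback.hom_ext <;> simp)
        rw [← Category.assoc, ← hs1, ← Category.assoc b, ← hs2]
        simpa using s ≫= hπ)
      refine ⟨u, hv.cancel ?_, ?_⟩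
      · rw [reassoc_of% hu, hwQ, hk]
      · intro Z z y h h'
        obtain ⟨Z', e', z', he', hz'⟩ := hE.local_lift hv z
        refine he'.cancel ?_
        have c1 : (z' ≫ k) ≫ w = (e' ≫ y) ≫ p := by
          rw [Category.assoc, hk, reassoc_of% hz', h, Category.assoc]
        have c2 : (z' ≫ v) ≫ t = (e' ≫ y) ≫ p := by
          rw [← c1]; simp [hk]
        have c3 : (e' ≫ z ≫ u) ≫ wQ = (e' ≫ y) ≫ p := by
          simp only [Category.assoc] at h' ⊢; rw [h']
        have e1 := hkd' z' (e' ≫ y) c2 c1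
        have e2 := hev (z' ≫ k) (e' ≫ z ≫ u) (e' ≫ y) c1 c3 (by
          rw [Category.assoc, ← hu, reassoc_of% hz'])
        have e3 := e2.trans e1
        rw [← Category.assoc, ← Category.assoc]
        convert e3 using 2
        · apply pullback.hom_ext <;> simp
        · apply pullback.hom_ext <;> simp [hz']
    · rintro u u' ⟨hu, hud⟩ ⟨hu', hud'⟩
      obtain ⟨Z₁, e₁, k₁, he₁, hk₁⟩ := hE.local_lift hπe u
      obtain ⟨Z₂, e₂, k₂, he₂, hk₂⟩ := hE.local_lift hπe (e₁ ≫ u')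
      refine he₁.cancel (he₂.cancel ?_)
      obtain ⟨s, hs1, hs2⟩ := hR2 (e₂ ≫ k₁) k₂
        (by rw [← hwQ, reassoc_of% hk₂, hu', Category.assoc, reassoc_of% hk₁, hu]) (by
          intro Z z y h h'
          have c0 : (z ≫ e₂ ≫ e₁) ≫ t = y ≫ p := by
            rw [← h, ← hwQ]; simp [reassoc_of% hk₁, hu]
          have c1 : ((z ≫ e₂ ≫ e₁) ≫ u) ≫ wQ = y ≫ p := by
            rw [Category.assoc, hu, c0]
          have c2 : ((z ≫ e₂ ≫ e₁) ≫ u') ≫ wQ = y ≫ p := by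
            rw [Category.assoc, hu', c0]
          have e1 := hud (z ≫ e₂ ≫ e₁) y c0 c1
          have e2 := hud' (z ≫ e₂ ≫ e₁) y c0 c2
          rw [← hev (z ≫ e₂ ≫ k₁) _ y h c1 (by simp [hk₁]),
            ← hev (z ≫ k₂) _ y h' c2 (by simp [hk₂]), e1, e2])
      rw [← hk₁, ← hk₂, ← Category.assoc, ← hs1, ← hs2]
      simpa using s ≫= hπ

/-- Weak dependent products from exponentials in slices. -/
lemma wdp_of_exp (hEP : EnoughRegProjectives E)
    (hx : ∀ ⦃F G I : E⦄ (p : F ⟶ I) (q : G ⟶ I), HasExp p q) :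
    HasWeakDependentProducts {X : E | RegProjective X} := by
  intro X J Y hX hJ hY f g
  obtain ⟨R, r, φ, hφ, hR⟩ := hx f (g ≫ f)
  obtain ⟨R', r', φ', hφ', hR'⟩ := hx f f
  obtain ⟨u₁, ⟨hu₁, hv₁⟩, -⟩ := hR' r (φ ≫ g) (by simpa using hφ)
  obtain ⟨u₂, ⟨hu₂, hv₂⟩, -⟩ := hR' r (pullback.snd _ _) pullback.condition.symm
  obtain ⟨S, ι, hι, hSl⟩ : ∃ (S : E) (ι : S ⟶ R), ι ≫ u₁ = ι ≫ u₂ ∧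
      ∀ ⦃T : E⦄ (u : T ⟶ R), u ≫ u₁ = u ≫ u₂ → ∃ l : T ⟶ S, l ≫ ι = u :=
    ⟨equalizer u₁ u₂, equalizer.ι _ _, equalizer.condition _ _,
      fun T u h => ⟨equalizer.lift u h, equalizer.lift_ι _ _⟩⟩
  obtain ⟨W, c, hW, hc⟩ := hEP S
  have hcond : ∀ ⦃T : E⦄ (h : T ⟶ J) (k : T ⟶ W), k ≫ c ≫ ι ≫ r = h →
      (pullback.fst h f ≫ k ≫ c ≫ ι) ≫ r = pullback.snd h f ≫ f := by
    intro T h k hk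
    rw [← pullback.condition, ← hk]; simp
  refine ⟨W, hW, c ≫ ι ≫ r, fun T hT h k hk =>
    pullback.lift (pullback.fst h f ≫ k ≫ c ≫ ι) (pullback.snd h f) (hcond h k hk) ≫ φ, ?_, ?_, ?_⟩
  · intro T hT h k hk
    have c1 := hcond h k hk
    have d1 : ((pullback.fst h f ≫ k ≫ c ≫ ι) ≫ u₁) ≫ r' = pullback.snd h f ≫ f := by
      rw [Category.assoc, hu₁, c1]
    have d2 : ((pullback.fst h f ≫ k ≫ c ≫ ι) ≫ u₂) ≫ r' = pullback.snd h f ≫ f := by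
      rw [Category.assoc, hu₂, c1]
    have e1 := hv₁ _ _ c1 d1
    have e2 := hv₂ _ _ c1 d2
    have e3 : pullback.lift _ _ d1 = pullback.lift _ _ d2 := by
      apply pullback.hom_ext <;> simp [hι]
    rw [Category.assoc, ← e1, e3, e2]; simp
  · intro T hT h d hd
    obtain ⟨u, ⟨hu, hv⟩, -⟩ := hR h d (by rw [reassoc_of% hd, pullback.condition])
    obtain ⟨l, hl⟩ := hSl u (by
      obtain ⟨u₀, -, huniq⟩ := hR' h (pullback.snd _ _) pullback.condition.symm
      rw [huniq (u ≫ u₁) ?_, huniq (u ≫ u₂) ?_]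
      · refine ⟨by rw [Category.assoc, hu₂, hu], fun Z z y h1 h2 => ?_⟩
        have := hv₂ (z ≫ u) y (by simpa [hu] using h1) (by simpa using h2)
        simp only [Category.assoc] at this
        rw [this]; simp
      · refine ⟨by rw [Category.assoc, hu₁, hu], fun Z z y h1 h2 => ?_⟩
        have := hv₁ (z ≫ u) y (by simpa [hu] using h1) (by simpa using h2)
        simp only [Category.assoc] at this
        rw [this, reassoc_of% (hv z y h1 (by simpa [hu] using h1)), hd])
    obtain ⟨k, hk⟩ := hT c hc l
    have hk' : k ≫ c ≫ ι = u := by rw [reassoc_of% hk, hl]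
    refine ⟨k, by rw [reassoc_of% hk', hu], ?_⟩
    have := hv (pullback.fst h f) (pullback.snd h f) pullback.condition
      (by rw [Category.assoc, hu, pullback.condition])
    simp only [hk']
    rw [this]; simp
  · intro T' T hT' hT u h k hk
    beta_reduce
    refine Eq.trans ?_ (Category.assoc _ _ _)
    congr 1
    apply pullback.hom_ext <;> simp

open Over in
lemma lift_prodmap {I : E} (F : Over I) {T R : Over I} (U : T ⟶ R) {Z : E} (z : Z ⟶ T.left)
    (y : Z ⟶ F.left) (h : z ≫ T.hom = y ≫ F.hom) (h' : (z ≫ U.left) ≫ R.hom = y ≫ F.hom) :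
    pullback.lift z y h ≫ (prodLeftIsoPullback T F).inv ≫ (prod.map U (𝟙 F)).left =
      pullback.lift (z ≫ U.left) y h' ≫ (prodLeftIsoPullback R F).inv := by
  rw [← Category.assoc, Iso.eq_comp_inv]
  apply pullback.hom_ext
  · simp only [Category.assoc, prodLeftIsoPullback_hom_fst, ← Over.comp_left, prod.map_fst]
    rw [Over.comp_left, reassoc_of% (prodLeftIsoPullback_inv_fst T F)]
    simp
  · simp only [Category.assoc, prodLeftIsoPullback_hom_snd, ← Over.comp_left, prod.map_snd]
    rw [Over.comp_left, reassoc_of% (prodLeftIsoPullback_inv_snd T F)]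
    simp

open Over in
lemma prodmap_iff {I : E} {F G T R : Over I} (U : T ⟶ R) (κ : R ⨯ F ⟶ G) (D : T ⨯ F ⟶ G) :
    prod.map U (𝟙 F) ≫ κ = D ↔ ∀ ⦃Z : E⦄ (z : Z ⟶ T.left) (y : Z ⟶ F.left)
      (h : z ≫ T.hom = y ≫ F.hom) (h' : (z ≫ U.left) ≫ R.hom = y ≫ F.hom),
      pullback.lift (z ≫ U.left) y h' ≫ (prodLeftIsoPullback R F).inv ≫ κ.left =
        pullback.lift z y h ≫ (prodLeftIsoPullback T F).inv ≫ D.left := by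
  constructor
  · rintro rfl Z z y h h'
    rw [← reassoc_of% (lift_prodmap F U z y h h')]; simp
  · intro H
    apply Over.OverMorphism.ext
    have c1 := pullback.condition (f := T.hom) (g := F.hom)
    have c2 : (pullback.fst T.hom F.hom ≫ U.left) ≫ R.hom = pullback.snd _ _ ≫ F.hom := by
      rw [Category.assoc, Over.w, c1]
    have := H _ _ c1 c2
    rw [← reassoc_of% (lift_prodmap F U _ _ c1 c2)] at this
    simp only [pullback.lift_fst_snd, Category.id_comp] at this
    rw [cancel_epi] at this
    simpa using this

open Over in
lemma exp_of_isLeftAdjoint {F G I : E} (p : F ⟶ I) (q : G ⟶ I)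
    (h : ((prod.functor (C := Over I)).flip.obj (Over.mk p)).IsLeftAdjoint) : HasExp p q := by
  have adj := Adjunction.ofIsLeftAdjoint ((prod.functor (C := Over I)).flip.obj (Over.mk p))
  obtain ⟨R, κ, hκ⟩ : ∃ (R : Over I) (κ : R ⨯ Over.mk p ⟶ Over.mk q),
      ∀ (T : Over I) (D : T ⨯ Over.mk p ⟶ Over.mk q),
        ∃! U : T ⟶ R, prod.map U (𝟙 _) ≫ κ = D := by
    refine ⟨_, adj.counit.app (Over.mk q), fun T D => ?_⟩
    refine ⟨adj.homEquiv _ _ D, ?_, ?_⟩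
    · exact (adj.homEquiv_counit _ _ _).symm.trans ((adj.homEquiv _ _).symm_apply_apply D)
    · intro U hU
      refine ((adj.homEquiv _ _).apply_symm_apply U).symm.trans (congrArg (adj.homEquiv _ _) ?_)
      exact (adj.homEquiv_counit _ _ U).trans hU
  refine ⟨R.left, R.hom, (prodLeftIsoPullback R (Over.mk p)).inv ≫ κ.left, ?_, ?_⟩
  · have := Over.w κ
    have e : (prod.fst (X := R) (Y := Over.mk p)).left ≫ R.hom = (R ⨯ Over.mk p).hom := Over.w _
    simp only [Over.mk_hom] at this
    rw [Category.assoc, this, ← e, reassoc_of% (prodLeftIsoPullback_inv_fst R (Over.mk p))]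
    rfl
  · intro T t d hd
    obtain ⟨D, hD⟩ : ∃ D : Over.mk t ⨯ Over.mk p ⟶ Over.mk q,
        (prodLeftIsoPullback (Over.mk t) (Over.mk p)).inv ≫ D.left = d := by
      refine ⟨Over.homMk ((prodLeftIsoPullback (Over.mk t) (Over.mk p)).hom ≫ d) ?_, ?_⟩
      · have e : (prod.fst (X := Over.mk t) (Y := Over.mk p)).left ≫ (Over.mk t).hom
          = (Over.mk t ⨯ Over.mk p).hom := Over.w _
        have e2 := prodLeftIsoPullback_hom_fst (Over.mk t) (Over.mk p)
        rw [← e, ← e2, Category.assoc, Category.assoc]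
        exact _ ≫= hd
      · simp
    obtain ⟨U, hU, huniq⟩ := hκ _ D
    have hU' := (prodmap_iff U κ D).1 hU
    rw [hD] at hU'
    refine ⟨U.left, ⟨Over.w U, hU'⟩, ?_⟩
    rintro u ⟨hu, hud⟩
    have : Over.homMk (U := Over.mk t) (V := R) u hu = U := by
      apply huniq
      rw [prodmap_iff, hD]
      exact hud
    rw [← this]; rfl

open Over in
lemma isLeftAdjoint_of_exp {I : E} (F : Over I) (h : ∀ G : Over I, HasExp F.hom G.hom) :
    ((prod.functor (C := Over I)).flip.obj F).IsLeftAdjoint := by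
  rw [isLeftAdjoint_iff_hasTerminal_costructuredArrow]
  intro G
  obtain ⟨R, r, φ, hφ, hR⟩ := h G
  obtain ⟨κ, hκ⟩ : ∃ κ : Over.mk r ⨯ F ⟶ G,
      (prodLeftIsoPullback (Over.mk r) F).inv ≫ κ.left = φ := by
    refine ⟨Over.homMk ((prodLeftIsoPullback (Over.mk r) F).hom ≫ φ) ?_, ?_⟩
    · have e : (prod.fst (X := Over.mk r) (Y := F)).left ≫ (Over.mk r).hom
          = (Over.mk r ⨯ F).hom := Over.w _
      have e2 := prodLeftIsoPullback_hom_fst (Over.mk r) F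
      rw [← e, ← e2, Category.assoc, Category.assoc]
      exact _ ≫= hφ
    · simp
  have huniv : ∀ (T : Over I) (D : T ⨯ F ⟶ G),
      ∃! U : T ⟶ Over.mk r, prod.map U (𝟙 _) ≫ κ = D := by
    intro T D
    have hd : ((prodLeftIsoPullback T F).inv ≫ D.left) ≫ G.hom
        = pullback.fst T.hom F.hom ≫ T.hom := by
      have e : (prod.fst (X := T) (Y := F)).left ≫ T.hom = (T ⨯ F).hom := Over.w _
      rw [Category.assoc, Over.w D, ← e, reassoc_of% (prodLeftIsoPullback_inv_fst T F)]
    obtain ⟨u, ⟨hu, hud⟩, huniq⟩ := hR T.hom _ hd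
    refine ⟨Over.homMk u hu, ?_, ?_⟩
    · beta_reduce
      rw [prodmap_iff, hκ]
      exact hud
    · intro U hU
      apply Over.OverMorphism.ext
      rw [prodmap_iff, hκ] at hU
      exact huniq U.left ⟨Over.w U, hU⟩
  choose U hU huniq using huniv
  let X : CostructuredArrow ((prod.functor (C := Over I)).flip.obj F) G :=
    CostructuredArrow.mk (Y := Over.mk r) κ
  have : IsTerminal X := IsTerminal.ofUniqueHom
    (fun A => CostructuredArrow.homMk (U A.left A.hom) (hU A.left A.hom)) (by
      intro A k
      apply CostructuredArrow.ext
      exact huniq A.left A.hom k.left (CostructuredArrow.w k))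
  exact this.hasTerminal

end Aux

end FinLim2

/-- If the projectives of `E` are closed under pullbacks, then `E` is
locally cartesian closed iff the full subcategory of projectives has weak dependent
products. -/
theorem stmt7 {E : Type u} [Category.{v} E] [HasFiniteLimits E]
    (hE : IsExact E) (hEP : EnoughRegProjectives E)
    (hclosed : ∀ ⦃X Y Z : E⦄ (f : X ⟶ Z) (g : Y ⟶ Z), RegProjective X →
      RegProjective Y → RegProjective Z → RegProjective (pullback f g)) :
    LocallyCartesianClosedP E ↔ HasWeakDependentProducts {X : E | RegProjective X} := by
  constructor
  · intro h
    exact wdp_of_exp hEP (fun F G I p q => exp_of_isLeftAdjoint p q (h I (Over.mk p)))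
  · intro h I F
    exact isLeftAdjoint_of_exp F (fun G => exists_exp hE hEP hclosed h F.hom G.hom)

end ExComp
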